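/- There is a universal constant C > 0 such that for every ε ∈ (0,1), every natural numbers n ≥ 2 and m ≥ 1, every integer k ≥ C·log(n)/ε², and every set P of n points of the form (z, x) with z > 0 and x ∈ ℝ^m, there exists a map g : P → (0,∞) × ℝ^k such that (1 − ε)·d_H(p, p') ≤ d_H(g(p), g(p')) ≤ (1 + ε)·d_H(p, p') for all p, p' ∈ P, where d_H((z,x),(z',x')) = arcosh(1 + (‖x − x'‖² + (z − z')²)/(2·z·z')). -/

import Mathlib

/-- The inverse hyperbolic cosine. -/
noncomputable def arcosh (x : ℝ) : ℝ := Real.log (x + Real.sqrt (x ^ 2 - 1))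

/-- The hyperbolic distance, in the Poincaré half-space model, between points
`(z, x)` and `(z', x')` with heights `z, z' > 0`. -/
noncomputable def dH {E : Type*} [NormedAddCommGroup E] (z : ℝ) (x : E) (z' : ℝ) (x' : E) : ℝ :=
  arcosh (1 + (‖x - x'‖ ^ 2 + (z - z') ^ 2) / (2 * z * z'))

lemma arcosh_eq_real_arcosh (x : ℝ) : arcosh x = Real.arcosh x := rfl

lemma sinh_mul_le_mul_sinh {c t : ℝ} (hc : 0 ≤ c) (hc1 : c ≤ 1) (ht : 0 ≤ t) :
    Real.sinh (c * t) ≤ c * Real.sinh t := by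
  have hconv : ConvexOn ℝ (Set.Ici 0) Real.sinh := by
    refine MonotoneOn.convexOn_of_deriv (convex_Ici 0) Real.continuous_sinh.continuousOn
      Real.differentiable_sinh.differentiableOn ?_
    rw [Real.deriv_sinh, interior_Ici]
    exact Real.cosh_strictMonoOn.monotoneOn.mono Set.Ioi_subset_Ici_self
  simpa using hconv.2 (x := t) ht (y := 0) Set.self_mem_Ici hc (sub_nonneg.2 hc1) (by ring)

lemma mul_sinh_le_sinh_mul {c t : ℝ} (hc : 1 ≤ c) (ht : 0 ≤ t) :
    c * Real.sinh t ≤ Real.sinh (c * t) := by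
  have hc0 : 0 < c := by linarith
  have h := sinh_mul_le_mul_sinh (inv_nonneg.2 hc0.le) (inv_le_one_of_one_le₀ hc)
    (mul_nonneg hc0.le ht)
  rw [inv_mul_cancel_left₀ hc0.ne'] at h
  rwa [← le_inv_mul_iff₀ hc0]

lemma cosh_sub_one (t : ℝ) : Real.cosh t - 1 = 2 * Real.sinh (t / 2) ^ 2 := by
  have h := Real.cosh_two_mul (t / 2)
  rw [mul_div_cancel₀ t two_ne_zero, Real.cosh_sq] at h
  linarith

lemma arcosh_le_mul_arcosh {c a b : ℝ} (hc : 1 ≤ c) (ha : 0 ≤ a) (hb : 0 ≤ b)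
    (h : b ≤ c * a) : arcosh (1 + b) ≤ c * arcosh (1 + a) := by
  simp only [arcosh_eq_real_arcosh]
  have ht := Real.arcosh_nonneg (x := 1 + a) (by linarith)
  set t := Real.arcosh (1 + a)
  have hcosh : Real.cosh t = 1 + a := Real.cosh_arcosh (by linarith)
  have hct : 0 ≤ c * t := by positivity
  rw [← Real.arcosh_cosh hct, Real.arcosh_le_arcosh (by linarith) (Real.cosh_pos _)]
  have h1 := cosh_sub_one t
  have h2 := cosh_sub_one (c * t)
  have hs : 0 ≤ Real.sinh (t / 2) := Real.sinh_nonneg_iff.2 (by linarith)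
  have h3 := mul_sinh_le_sinh_mul hc (t := t / 2) (by linarith)
  rw [← mul_div_assoc] at h3
  have h4 := pow_le_pow_left₀ (by positivity) h3 2
  have h5 : c * Real.sinh (t / 2) ^ 2 ≤ (c * Real.sinh (t / 2)) ^ 2 := by
    rw [mul_pow]
    exact mul_le_mul_of_nonneg_right (by nlinarith) (sq_nonneg _)
  nlinarith

lemma mul_arcosh_le_arcosh {c a b : ℝ} (hc : 0 ≤ c) (hc1 : c ≤ 1) (ha : 0 ≤ a) (hb : 0 ≤ b)
    (h : c * a ≤ b) : c * arcosh (1 + a) ≤ arcosh (1 + b) := by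
  simp only [arcosh_eq_real_arcosh]
  have ht := Real.arcosh_nonneg (x := 1 + a) (by linarith)
  set t := Real.arcosh (1 + a)
  have hcosh : Real.cosh t = 1 + a := Real.cosh_arcosh (by linarith)
  have hct : 0 ≤ c * t := by positivity
  rw [← Real.arcosh_cosh hct, Real.arcosh_le_arcosh (Real.cosh_pos _) (by linarith)]
  have h1 := cosh_sub_one t
  have h2 := cosh_sub_one (c * t)
  have hs : 0 ≤ Real.sinh (c * t / 2) := Real.sinh_nonneg_iff.2 (by linarith)
  have h3 := sinh_mul_le_mul_sinh hc hc1 (t := t / 2) (by linarith)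
  rw [← mul_div_assoc] at h3
  have h4 := pow_le_pow_left₀ hs h3 2
  have h5 : (c * Real.sinh (t / 2)) ^ 2 ≤ c * Real.sinh (t / 2) ^ 2 := by
    rw [mul_pow]
    exact mul_le_mul_of_nonneg_right (by nlinarith) (sq_nonneg _)
  nlinarith

lemma dH_bounds {E F : Type*} [NormedAddCommGroup E] [NormedAddCommGroup F]
    {ε z z' : ℝ} (h0 : 0 < ε) (h1 : ε < 1)
    (hz : 0 < z) (hz' : 0 < z') {x x' : E} {y y' : F}
    (hl : (1 - ε) * ‖x - x'‖ ^ 2 ≤ ‖y - y'‖ ^ 2) (hu : ‖y - y'‖ ^ 2 ≤ (1 + ε) * ‖x - x'‖ ^ 2) :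
    (1 - ε) * dH z x z' x' ≤ dH z y z' y' ∧ dH z y z' y' ≤ (1 + ε) * dH z x z' x' := by
  have hsq := mul_nonneg h0.le (sq_nonneg (z - z'))
  refine ⟨mul_arcosh_le_arcosh (by linarith) (by linarith) (by positivity) (by positivity) ?_,
    arcosh_le_mul_arcosh (by linarith) (by positivity) (by positivity) ?_⟩ <;>
  · rw [← mul_div_assoc]
    gcongr
    nlinarith

lemma card_mul_exp_lt_one {n : ℕ} (hn : 2 ≤ n) {a : ℝ} (ha : 4 * Real.log n ≤ a) :
    (n ^ 2 : ℝ) * (2 * Real.exp (-a)) < 1 := by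
  have hn' : (2 : ℝ) ≤ n := by exact_mod_cast hn
  have hexp : Real.exp (-a) ≤ ((n : ℝ) ^ 4)⁻¹ := by
    rw [Real.exp_neg, ← Real.exp_log (x := (n : ℝ) ^ 4) (by positivity), Real.log_pow]
    gcongr
    exact_mod_cast ha
  grw [hexp]
  field_simp
  nlinarith

section Gaussian

open MeasureTheory ProbabilityTheory

lemma integral_exp_mul_sq_gaussianReal (s : ℝ) :
    ∫ x, Real.exp (s * x ^ 2) ∂gaussianReal 0 1 = (√(1 - 2 * s))⁻¹ := by
  rw [integral_gaussianReal_eq_integral_smul one_ne_zero]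
  have : ∀ x : ℝ, gaussianPDFReal 0 1 x • Real.exp (s * x ^ 2)
      = (√(2 * Real.pi))⁻¹ * Real.exp (-(1 / 2 - s) * x ^ 2) := by
    intro x
    simp only [gaussianPDFReal_def, smul_eq_mul, mul_assoc, ← Real.exp_add, NNReal.coe_one, mul_one]
    ring_nf
  simp_rw [this]
  rw [integral_const_mul, integral_gaussian, ← Real.sqrt_inv, ← Real.sqrt_mul (by positivity),
    ← Real.sqrt_inv]
  congr 1
  rw [show 1 - 2 * s = 2 * (1 / 2 - s) by ring, mul_inv, mul_inv]
  field_simp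

variable {E : Type*} [NormedAddCommGroup E] [InnerProductSpace ℝ E]

/-- The sum of the exponential moments controlling the upper and lower deviations of
`∑ l, ⟪u, ω l⟫ ^ 2` from `k` by `ε * k`. -/
noncomputable def deviation {k : ℕ} (ε : ℝ) (u : E) (ω : Fin k → E) : ℝ :=
  Real.exp (-(ε / 8 * (1 + ε) * k)) * Real.exp (ε / 8 * ∑ l, inner ℝ u (ω l) ^ 2) +
    Real.exp (ε / 8 * (1 - ε) * k) * Real.exp (-(ε / 8) * ∑ l, inner ℝ u (ω l) ^ 2)

lemma bounds_of_deviation_lt_one {k : ℕ} {ε : ℝ} (h0 : 0 < ε) {u : E} {ω : Fin k → E}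
    (h : deviation ε u ω < 1) :
    (1 - ε) * k ≤ ∑ l, inner ℝ u (ω l) ^ 2 ∧ ∑ l, inner ℝ u (ω l) ^ 2 ≤ (1 + ε) * k := by
  rw [deviation, ← Real.exp_add, ← Real.exp_add] at h
  have hu := Real.exp_lt_one_iff.1 ((lt_add_of_pos_right _ (Real.exp_pos _)).trans h)
  have hl := Real.exp_lt_one_iff.1 ((lt_add_of_pos_left _ (Real.exp_pos _)).trans h)
  constructor <;> nlinarith

variable [FiniteDimensional ℝ E] [MeasurableSpace E] [BorelSpace E]

lemma map_inner_stdGaussian {u : E} (hu : ‖u‖ = 1) :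
    (stdGaussian E).map (fun x ↦ inner ℝ u x) = gaussianReal 0 1 := by
  have h := IsGaussian.map_eq_gaussianReal (μ := stdGaussian E) (innerSL ℝ u)
  rw [integral_strongDual_stdGaussian, variance_dual_stdGaussian, innerSL_apply_norm, hu] at h
  simpa using h

lemma integral_exp_mul_inner_sq {u : E} (hu : ‖u‖ = 1) (s : ℝ) :
    ∫ x, Real.exp (s * inner ℝ u x ^ 2) ∂stdGaussian E = (√(1 - 2 * s))⁻¹ := by
  rw [← integral_exp_mul_sq_gaussianReal, ← map_inner_stdGaussian hu,
    integral_map (by fun_prop) (by fun_prop)]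

lemma integral_exp_mul_sum_inner_sq {u : E} (hu : ‖u‖ = 1) (s : ℝ) (k : ℕ) :
    ∫ ω, Real.exp (s * ∑ l, inner ℝ u (ω l) ^ 2) ∂Measure.pi (fun _ : Fin k ↦ stdGaussian E)
      = ((√(1 - 2 * s))⁻¹) ^ k := by
  simp_rw [Finset.mul_sum, Real.exp_sum]
  rw [integral_fintype_prod_eq_prod (fun _ x ↦ Real.exp (s * inner ℝ u x ^ 2))]
  simp [integral_exp_mul_inner_sq hu]

lemma inv_sqrt_one_sub_two_mul_le {s : ℝ} (hs : s ≤ 1 / 4) :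
    (√(1 - 2 * s))⁻¹ ≤ Real.exp (s + 4 * s ^ 2) := by
  have hpos : 0 < 1 - 2 * s := by linarith
  have hlog := Real.one_sub_inv_le_log_of_pos hpos
  have hinv : (1 - 2 * s)⁻¹ ≤ 1 + 2 * s + 8 * s ^ 2 := by
    rw [inv_le_iff_one_le_mul₀ hpos]
    nlinarith [mul_nonneg (sq_nonneg s) (sub_nonneg.2 hs)]
  rw [← Real.exp_log (inv_pos.2 (Real.sqrt_pos.2 hpos)), Real.exp_le_exp, Real.log_inv,
    Real.log_sqrt hpos.le]
  linarith

lemma integrable_exp_mul_sum_inner_sq {u : E} (hu : ‖u‖ = 1) {s : ℝ} (hs : 0 < 1 - 2 * s) (k : ℕ) :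
    Integrable (fun ω ↦ Real.exp (s * ∑ l, inner ℝ u (ω l) ^ 2))
      (Measure.pi (fun _ : Fin k ↦ stdGaussian E)) := by
  refine .of_integral_ne_zero ?_
  rw [integral_exp_mul_sum_inner_sq hu]
  positivity

lemma integrable_deviation {ε : ℝ} (h0 : 0 < ε) (h1 : ε < 1) {u : E} (hu : ‖u‖ = 1) (k : ℕ) :
    Integrable (deviation ε u) (Measure.pi (fun _ : Fin k ↦ stdGaussian E)) :=
  ((integrable_exp_mul_sum_inner_sq hu (by linarith) k).const_mul _).add
    ((integrable_exp_mul_sum_inner_sq hu (by linarith) k).const_mul _)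

lemma integral_deviation_le {ε : ℝ} (h0 : 0 < ε) (h1 : ε < 1) {u : E} (hu : ‖u‖ = 1) (k : ℕ) :
    ∫ ω, deviation ε u ω ∂Measure.pi (fun _ : Fin k ↦ stdGaussian E)
      ≤ 2 * Real.exp (-(ε ^ 2 / 16 * k)) := by
  simp only [deviation]
  rw [integral_add ((integrable_exp_mul_sum_inner_sq hu (by linarith) k).const_mul _)
    ((integrable_exp_mul_sum_inner_sq hu (by linarith) k).const_mul _), integral_const_mul,
    integral_const_mul, integral_exp_mul_sum_inner_sq hu, integral_exp_mul_sum_inner_sq hu,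
    two_mul (Real.exp _)]
  refine add_le_add ?_ ?_
  · grw [inv_sqrt_one_sub_two_mul_le (s := ε / 8) (by linarith)]
    rw [← Real.exp_nat_mul, ← Real.exp_add]
    exact (congrArg Real.exp (by ring)).le
  · grw [inv_sqrt_one_sub_two_mul_le (s := -(ε / 8)) (by linarith)]
    rw [← Real.exp_nat_mul, ← Real.exp_add]
    exact (congrArg Real.exp (by ring)).le

/-- The Euclidean Johnson–Lindenstrauss lemma: a linear map to `ℝ^k` that nearly preserves the
norms of finitely many given vectors. -/
theorem exists_linearMap_norm_sq_bounds [Nontrivial E] {ι : Type*} [Fintype ι] (v : ι → E)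
    {ε : ℝ} (h0 : 0 < ε) (h1 : ε < 1) {k : ℕ} (hk : 0 < k)
    (hcard : Fintype.card ι * (2 * Real.exp (-(ε ^ 2 / 16 * k))) < 1) :
    ∃ T : E →ₗ[ℝ] EuclideanSpace ℝ (Fin k), ∀ i,
      (1 - ε) * ‖v i‖ ^ 2 ≤ ‖T (v i)‖ ^ 2 ∧ ‖T (v i)‖ ^ 2 ≤ (1 + ε) * ‖v i‖ ^ 2 := by
  have hunit : ∀ x : E, ∃ u : E, ‖u‖ = 1 ∧ x = ‖x‖ • u := by
    intro x
    by_cases hx : x = 0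
    · obtain ⟨u, hu⟩ := exists_norm_eq E zero_le_one
      exact ⟨u, hu, by simp [hx]⟩
    · exact ⟨‖x‖⁻¹ • x, by simp [norm_smul, hx], by simp [smul_smul, hx]⟩
  choose u hu huv using fun i ↦ hunit (v i)
  obtain ⟨ω, hω⟩ := exists_le_integral (μ := Measure.pi (fun _ : Fin k ↦ stdGaussian E))
    (f := fun ω ↦ ∑ i, deviation ε (u i) ω)
    (integrable_finsetSum _ fun i _ ↦ integrable_deviation h0 h1 (hu i) k)
  have hlt : ∑ i, deviation ε (u i) ω < 1 := by
    refine hω.trans_lt (lt_of_le_of_lt ?_ hcard)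
    rw [integral_finsetSum _ fun i _ ↦ integrable_deviation h0 h1 (hu i) k, ← nsmul_eq_mul]
    exact Finset.sum_le_card_nsmul _ _ _ fun i _ ↦ integral_deviation_le h0 h1 (hu i) k
  have hdev : ∀ i, deviation ε (u i) ω < 1 := fun i ↦
    (Finset.single_le_sum (f := fun i ↦ deviation ε (u i) ω)
      (fun j _ ↦ by unfold deviation; positivity) (Finset.mem_univ i)).trans_lt hlt
  let T : E →ₗ[ℝ] EuclideanSpace ℝ (Fin k) := (√k)⁻¹ •
    (WithLp.linearEquiv 2 ℝ (Fin k → ℝ)).symm.toLinearMap ∘ₗ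
      LinearMap.pi fun l ↦ (innerSL ℝ (ω l)).toLinearMap
  have hk' : (0 : ℝ) < k := by exact_mod_cast hk
  have hT : ∀ x, k * ‖T x‖ ^ 2 = ∑ l, inner ℝ x (ω l) ^ 2 := by
    intro x
    have : ‖T x‖ ^ 2 = (k : ℝ)⁻¹ * ∑ l, inner ℝ x (ω l) ^ 2 := by
      simp [T, norm_smul, mul_pow, EuclideanSpace.norm_sq_eq, real_inner_comm]
    rw [this, mul_inv_cancel_left₀ hk'.ne']
  refine ⟨T, fun i ↦ ?_⟩
  obtain ⟨hl, hr⟩ := bounds_of_deviation_lt_one h0 (hdev i)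
  rw [← hT, mul_comm _ (k : ℝ), mul_le_mul_iff_right₀ hk'] at hl hr
  have hTv : ‖T (v i)‖ ^ 2 = ‖v i‖ ^ 2 * ‖T (u i)‖ ^ 2 := by
    conv_lhs => rw [huv i, map_smul, norm_smul, norm_norm, mul_pow]
  rw [hTv, mul_comm _ (‖v i‖ ^ 2), mul_comm _ (‖v i‖ ^ 2)]
  exact ⟨by gcongr, by gcongr⟩

end Gaussian

/-- Johnson–Lindenstrauss transform in hyperbolic space: there is a universal
constant `C > 0` such that any `n` points of hyperbolic space (half-space model
over `ℝ^m`) can be mapped into hyperbolic space over `ℝ^k`, for any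
`k ≥ C·log n / ε²`, with all pairwise hyperbolic distances preserved up to
factors `1 ± ε`. -/
theorem hyperbolic_johnson_lindenstrauss :
    ∃ C : ℝ, 0 < C ∧
      ∀ (ε : ℝ), 0 < ε → ε < 1 →
      ∀ (n m : ℕ), 2 ≤ n → 1 ≤ m →
      ∀ k : ℕ, C * Real.log n / ε ^ 2 ≤ k →
      ∀ p : Fin n → ℝ × EuclideanSpace ℝ (Fin m), (∀ i, 0 < (p i).1) →
        ∃ g : Fin n → ℝ × EuclideanSpace ℝ (Fin k), (∀ i, 0 < (g i).1) ∧
          ∀ i j,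
            (1 - ε) * dH (p i).1 (p i).2 (p j).1 (p j).2 ≤
              dH (g i).1 (g i).2 (g j).1 (g j).2 ∧
            dH (g i).1 (g i).2 (g j).1 (g j).2 ≤
              (1 + ε) * dH (p i).1 (p i).2 (p j).1 (p j).2 := by
  refine ⟨64, by norm_num, fun ε h0 h1 n m hn hm k hk p hp ↦ ?_⟩
  have hlog : 0 < Real.log n := Real.log_pos (by exact_mod_cast hn)
  have hk0 : 0 < k := by
    have : (0 : ℝ) < k := lt_of_lt_of_le (by positivity) hk
    exact_mod_cast this
  have : Nonempty (Fin m) := ⟨⟨0, hm⟩⟩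
  rw [div_le_iff₀ (by positivity)] at hk
  obtain ⟨T, hT⟩ := exists_linearMap_norm_sq_bounds
    (fun q : Fin n × Fin n ↦ (p q.1).2 - (p q.2).2) h0 h1 hk0 (by
      simpa [← pow_two] using card_mul_exp_lt_one hn (a := ε ^ 2 / 16 * k) (by linarith))
  refine ⟨fun i ↦ ((p i).1, T (p i).2), hp, fun i j ↦ ?_⟩
  have h := hT (i, j)
  simp only [map_sub] at h
  exact dH_bounds h0 h1 (hp i) (hp j) h.1 h.2
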